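/- Let K be a nondegenerate closed triangle in ℝ² with vertices P₁, P₂, P₃, and let v : ℝ² → ℝ be continuously differentiable on a neighborhood of K. If the line integral of v along each edge of K vanishes, i.e. ∫₀¹ v((1−t)Pᵢ + t·Pⱼ) dt = 0 for each of the three edges PᵢPⱼ, then ∫_K (∂v/∂x₁) dx = 0 and ∫_K (∂v/∂x₂) dx = 0. -/

import Mathlib

open MeasureTheory

/-- The closed unit right triangle in the plane. -/
def unitTriangle : Set (ℝ × ℝ) := {p | 0 ≤ p.1 ∧ 0 ≤ p.2 ∧ p.1 + p.2 ≤ 1}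

theorem isClosed_unitTriangle : IsClosed unitTriangle :=
  (isClosed_le continuous_const continuous_fst).inter
    ((isClosed_le continuous_const continuous_snd).inter
      (isClosed_le (continuous_fst.add continuous_snd) continuous_const))

theorem isCompact_unitTriangle : IsCompact unitTriangle := by
  refine (isCompact_Icc (a := ((0 : ℝ), (0 : ℝ))) (b := (1, 1))).of_isClosed_subset
    isClosed_unitTriangle ?_
  rintro ⟨s, t⟩ ⟨hs, ht, hst⟩
  simp only at hs ht hst
  exact ⟨⟨hs, ht⟩, ⟨by simp only; linarith, by simp only; linarith⟩⟩

/-- Fubini's theorem on the unit triangle. -/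
theorem setIntegral_unitTriangle {g : ℝ × ℝ → ℝ} (hg : ContinuousOn g unitTriangle) :
    ∫ p in unitTriangle, g p = ∫ s in (0 : ℝ)..1, ∫ t in (0 : ℝ)..(1 - s), g (s, t) := by
  have hint : IntegrableOn g unitTriangle := hg.integrableOn_compact isCompact_unitTriangle
  have hm : MeasurableSet unitTriangle := isClosed_unitTriangle.measurableSet
  rw [← integral_indicator hm, Measure.volume_eq_prod,
    integral_prod _ ((integrable_indicator_iff hm).2 hint),
    intervalIntegral.integral_of_le zero_le_one, ← integral_Icc_eq_integral_Ioc,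
    ← integral_indicator measurableSet_Icc]
  congr 1
  ext s
  by_cases hs : s ∈ Set.Icc (0 : ℝ) 1
  · rw [Set.indicator_of_mem hs, intervalIntegral.integral_of_le (by linarith [hs.2]),
      ← integral_Icc_eq_integral_Ioc, ← integral_indicator measurableSet_Icc]
    congr 1
    ext t
    have : (s, t) ∈ unitTriangle ↔ t ∈ Set.Icc 0 (1 - s) :=
      ⟨fun h => ⟨h.2.1, by linarith [h.2.2]⟩,
        fun h => ⟨hs.1, h.1, by simp only; linarith [h.2]⟩⟩
    simp only [Set.indicator, this]
  · rw [Set.indicator_of_notMem hs]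
    refine integral_eq_zero_of_ae (Filter.Eventually.of_forall fun t => ?_)
    refine Set.indicator_of_notMem (fun h => hs ⟨h.1, ?_⟩) _
    linarith [h.2.1, h.2.2]

/-- The linear map of the plane sending the standard basis to `a, b`. -/
def planeMap (a b : ℝ × ℝ) : ℝ × ℝ →L[ℝ] ℝ × ℝ :=
  (ContinuousLinearMap.fst ℝ ℝ ℝ).smulRight a + (ContinuousLinearMap.snd ℝ ℝ ℝ).smulRight b

theorem planeMap_apply (a b p : ℝ × ℝ) : planeMap a b p = p.1 • a + p.2 • b := rfl

theorem planeMap_injective {P₁ P₂ P₃ : ℝ × ℝ} (hP : ¬ Collinear ℝ {P₁, P₂, P₃}) :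
    Function.Injective (planeMap (P₂ - P₁) (P₃ - P₁)) := by
  rw [← affineIndependent_iff_not_collinear_set,
    affineIndependent_iff_linearIndependent_vsub ℝ _ (0 : Fin 3)] at hP
  have h2 := hP.comp (![⟨1, by decide⟩, ⟨2, by decide⟩] : Fin 2 → {x : Fin 3 // x ≠ 0})
    (by decide)
  have h3 : LinearIndependent ℝ ![P₂ - P₁, P₃ - P₁] := by
    have e : ![P₂ - P₁, P₃ - P₁] =
        (fun i : {x : Fin 3 // x ≠ 0} => ![P₁, P₂, P₃] i -ᵥ ![P₁, P₂, P₃] 0) ∘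
          ![⟨1, by decide⟩, ⟨2, by decide⟩] := by
      funext i
      fin_cases i <;> rfl
    rw [e]
    exact h2
  rw [LinearIndependent.pair_iff] at h3
  refine (injective_iff_map_eq_zero _).2 fun p hp => ?_
  rw [planeMap_apply] at hp
  exact Prod.ext (h3 _ _ hp).1 (h3 _ _ hp).2

theorem convexHull_triple_eq_image_unitTriangle (P₁ P₂ P₃ : ℝ × ℝ) :
    convexHull ℝ {P₁, P₂, P₃} =
      (fun p => P₁ + planeMap (P₂ - P₁) (P₃ - P₁) p) '' unitTriangle := by
  apply Set.Subset.antisymm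
  · refine convexHull_min ?_ ?_
    · rintro x (rfl | rfl | rfl)
      · exact ⟨(0, 0), by norm_num [unitTriangle], by simp [planeMap_apply]⟩
      · exact ⟨(1, 0), by norm_num [unitTriangle], by simp [planeMap_apply]⟩
      · exact ⟨(0, 1), by norm_num [unitTriangle], by simp [planeMap_apply]⟩
    · rintro _ ⟨p, ⟨hp1, hp2, hp3⟩, rfl⟩ _ ⟨q, ⟨hq1, hq2, hq3⟩, rfl⟩ c d hc hd hcd
      refine ⟨c • p + d • q, ⟨?_, ?_, ?_⟩, ?_⟩
      · simp only [Prod.fst_add, Prod.smul_fst, smul_eq_mul]; positivity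
      · simp only [Prod.snd_add, Prod.smul_snd, smul_eq_mul]; positivity
      · simp only [Prod.fst_add, Prod.smul_fst, Prod.snd_add, Prod.smul_snd, smul_eq_mul]
        nlinarith
      · obtain rfl : c = 1 - d := by linarith
        simp only [map_add, map_smul]
        module
  · rintro _ ⟨⟨s, t⟩, ⟨hs, ht, hst⟩, rfl⟩
    simp only at hs ht hst
    have hmem : ∀ x ∈ ({P₁, P₂, P₃} : Set (ℝ × ℝ)), x ∈ convexHull ℝ {P₁, P₂, P₃} :=
      fun x hx => subset_convexHull ℝ _ hx
    have key := (convex_convexHull ℝ {P₁, P₂, P₃}).sum_mem (t := Finset.univ)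
      (w := ![1 - s - t, s, t]) (z := ![P₁, P₂, P₃])
      (by
        intro i _
        fin_cases i
        · simp only [Fin.zero_eta, Matrix.cons_val_zero]; linarith
        · exact hs
        · exact ht)
      (by simp only [Fin.sum_univ_three, Matrix.cons_val]; ring)
      (by intro i _; fin_cases i <;> exact hmem _ (by simp))
    convert key using 1
    simp only [planeMap_apply, Fin.sum_univ_three, Matrix.cons_val]
    module

/-- The change of variables from a triangle to the unit triangle. -/
theorem setIntegral_convexHull_triple {P₁ P₂ P₃ : ℝ × ℝ} (hP : ¬ Collinear ℝ {P₁, P₂, P₃})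
    (g : ℝ × ℝ → ℝ) :
    ∫ x in convexHull ℝ {P₁, P₂, P₃}, g x =
      |(planeMap (P₂ - P₁) (P₃ - P₁)).det| *
        ∫ p in unitTriangle, g (P₁ + planeMap (P₂ - P₁) (P₃ - P₁) p) := by
  rw [convexHull_triple_eq_image_unitTriangle,
    integral_image_eq_integral_abs_det_fderiv_smul volume isClosed_unitTriangle.measurableSet
      (fun p _ => ((planeMap (P₂ - P₁) (P₃ - P₁)).hasFDerivAt.const_add P₁).hasFDerivWithinAt)
      (fun p _ q _ h => planeMap_injective hP (add_left_cancel h))]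
  simp only [smul_eq_mul, integral_const_mul]

/-- The integral over a triangle of the derivative along the edge `P₁P₃` vanishes when the
integrals along the two other edges coincide. -/
theorem setIntegral_fderiv_edge_eq_zero {P₁ P₂ P₃ : ℝ × ℝ}
    (hP : ¬ Collinear ℝ {P₁, P₂, P₃}) {v : ℝ × ℝ → ℝ} {U : Set (ℝ × ℝ)} (hU : IsOpen U)
    (hKU : convexHull ℝ {P₁, P₂, P₃} ⊆ U) (hv : ContDiffOn ℝ 1 v U)
    (h : ∫ t in (0 : ℝ)..1, v ((1 - t) • P₁ + t • P₂) =
      ∫ t in (0 : ℝ)..1, v ((1 - t) • P₃ + t • P₂)) :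
    ∫ x in convexHull ℝ {P₁, P₂, P₃}, fderiv ℝ v x (P₃ - P₁) = 0 := by
  set φ : ℝ × ℝ → ℝ × ℝ := fun p => P₁ + planeMap (P₂ - P₁) (P₃ - P₁) p with hφ
  have hφc : Continuous φ := by fun_prop
  have hmaps : Set.MapsTo φ unitTriangle U := fun p hp =>
    hKU (convexHull_triple_eq_image_unitTriangle P₁ P₂ P₃ ▸ Set.mem_image_of_mem φ hp)
  have hcont : ContinuousOn (fun p => fderiv ℝ v (φ p) (P₃ - P₁)) unitTriangle :=
    ((hv.continuousOn_fderiv_of_isOpen hU le_rfl).comp hφc.continuousOn hmaps).clm_apply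
      continuousOn_const
  have hvc : ContinuousOn (fun p => v (φ p)) unitTriangle :=
    hv.continuousOn.comp hφc.continuousOn hmaps
  rw [setIntegral_convexHull_triple hP, setIntegral_unitTriangle hcont]
  have hinner : ∀ s ∈ Set.uIcc (0 : ℝ) 1,
      ∫ t in (0 : ℝ)..(1 - s), fderiv ℝ v (φ (s, t)) (P₃ - P₁) =
        v ((1 - s) • P₃ + s • P₂) - v ((1 - s) • P₁ + s • P₂) := by
    intro s hs
    rw [Set.uIcc_of_le zero_le_one] at hs
    have hmem : Set.MapsTo (fun t : ℝ => (s, t)) (Set.uIcc 0 (1 - s)) unitTriangle := by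
      intro t ht
      rw [Set.uIcc_of_le (by linarith [hs.2])] at ht
      exact ⟨hs.1, ht.1, by simp only; linarith [ht.2]⟩
    rw [intervalIntegral.integral_eq_sub_of_hasDerivAt (f := fun t => v (φ (s, t)))]
    · congr 2 <;> simp only [hφ, planeMap_apply] <;> module
    · intro t ht
      have h1 : HasDerivAt (fun t : ℝ => φ (s, t)) (P₃ - P₁) t := by
        simpa [hφ, planeMap_apply, add_assoc] using
          (((hasDerivAt_id t).smul_const (P₃ - P₁)).const_add (s • (P₂ - P₁))).const_add P₁
      have h2 : DifferentiableAt ℝ v (φ (s, t)) :=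
        (hv.differentiableOn one_ne_zero).differentiableAt (hU.mem_nhds (hmaps (hmem ht)))
      exact h2.hasFDerivAt.comp_hasDerivAt t h1
    · exact (hcont.comp (by fun_prop) hmem).intervalIntegrable
  have hedge : ∀ c : ℝ → ℝ × ℝ, Continuous c → Set.MapsTo c (Set.uIcc 0 1) unitTriangle →
      IntervalIntegrable (fun s => v (φ (c s))) volume 0 1 := fun c hc hm =>
    (hvc.comp hc.continuousOn hm).intervalIntegrable
  have i1 := hedge (fun s => (s, 0)) (by fun_prop) (by
    intro s hs
    rw [Set.uIcc_of_le zero_le_one] at hs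
    exact ⟨hs.1, le_rfl, by simpa using hs.2⟩)
  have i3 := hedge (fun s => (s, 1 - s)) (by fun_prop) (by
    intro s hs
    rw [Set.uIcc_of_le zero_le_one] at hs
    exact ⟨hs.1, sub_nonneg.2 hs.2, by simp⟩)
  have e1 : ∀ s : ℝ, φ (s, 0) = (1 - s) • P₁ + s • P₂ := fun s => by
    simp only [hφ, planeMap_apply]; module
  have e3 : ∀ s : ℝ, φ (s, 1 - s) = (1 - s) • P₃ + s • P₂ := fun s => by
    simp only [hφ, planeMap_apply]; module
  simp only [e1] at i1
  simp only [e3] at i3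
  rw [intervalIntegral.integral_congr hinner, intervalIntegral.integral_sub i3 i1, h, sub_self,
    mul_zero]

theorem intervalIntegral_segment_symm (v : ℝ × ℝ → ℝ) (P Q : ℝ × ℝ) :
    ∫ t in (0 : ℝ)..1, v ((1 - t) • P + t • Q) =
      ∫ t in (0 : ℝ)..1, v ((1 - t) • Q + t • P) := by
  have := intervalIntegral.integral_comp_sub_left (a := 0) (b := 1)
    (fun t : ℝ => v ((1 - t) • Q + t • P)) 1
  simpa [add_comm] using this

/-- If `v` is `C¹` on a neighborhood of a nondegenerate closed triangle `K` with
vertices `P₁, P₂, P₃` and the line integral of `v` along each edge vanishes, then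
both mean first partial derivatives of `v` over `K` vanish. -/
theorem stmt_6
    (P₁ P₂ P₃ : ℝ × ℝ) (hP : ¬ Collinear ℝ {P₁, P₂, P₃})
    (K : Set (ℝ × ℝ)) (hK : K = convexHull ℝ {P₁, P₂, P₃})
    (v : ℝ × ℝ → ℝ)
    (hv : ∃ U : Set (ℝ × ℝ), IsOpen U ∧ K ⊆ U ∧ ContDiffOn ℝ 1 v U)
    (he12 : ∫ t in (0:ℝ)..1, v ((1 - t) • P₁ + t • P₂) = 0)
    (he13 : ∫ t in (0:ℝ)..1, v ((1 - t) • P₁ + t • P₃) = 0)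
    (he23 : ∫ t in (0:ℝ)..1, v ((1 - t) • P₂ + t • P₃) = 0) :
    (∫ x in K, fderiv ℝ v x (1, 0)) = 0 ∧ (∫ x in K, fderiv ℝ v x (0, 1)) = 0 := by
  subst hK
  obtain ⟨U, hU, hKU, hvU⟩ := hv
  have hswap : ({P₁, P₃, P₂} : Set (ℝ × ℝ)) = {P₁, P₂, P₃} := by rw [Set.pair_comm]
  have h3 := setIntegral_fderiv_edge_eq_zero hP hU hKU hvU
    (by rw [he12, intervalIntegral_segment_symm, he23])
  have h2 := setIntegral_fderiv_edge_eq_zero (P₁ := P₁) (P₂ := P₃) (P₃ := P₂)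
    (by rwa [hswap]) hU (by rwa [hswap]) hvU (by rw [he13, he23])
  rw [hswap] at h2
  have hcompact : IsCompact (convexHull ℝ {P₁, P₂, P₃}) :=
    (Set.toFinite _).isCompact_convexHull ℝ
  have hint (u : ℝ × ℝ) :
      IntegrableOn (fun x => fderiv ℝ v x u) (convexHull ℝ {P₁, P₂, P₃}) :=
    (((hvU.continuousOn_fderiv_of_isOpen hU le_rfl).mono hKU).clm_apply
      continuousOn_const).integrableOn_compact hcompact
  have hall (u : ℝ × ℝ) : ∫ x in convexHull ℝ {P₁, P₂, P₃}, fderiv ℝ v x u = 0 := by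
    obtain ⟨p, rfl⟩ := (LinearMap.injective_iff_surjective
      (f := (planeMap (P₂ - P₁) (P₃ - P₁)).toLinearMap)).1 (planeMap_injective hP) u
    simp only [ContinuousLinearMap.coe_coe, planeMap_apply, map_add, map_smul, smul_eq_mul]
    rw [integral_add ((hint _).const_mul _) ((hint _).const_mul _), integral_const_mul,
      integral_const_mul, h2, h3, mul_zero, mul_zero, add_zero]
  exact ⟨hall _, hall _⟩
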